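/- The Wilson Morse function W is strictly convex on ℝⁿ: its Hessian H_{jk}(x) = ∂²W/∂x_j∂x_k satisfies, for every x ∈ ℝⁿ and every y ∈ ℝⁿ with y ≠ 0, Σ_{1≤j,k≤n} y_j y_k H_{jk}(x) = Σ_{1≤j≤n} (Σ_{ε∈{a,b,c,d}} Re(ε/(ε² + x_j²))) y_j² + Σ_{1≤j<k≤n} ((y_j + y_k)²/(1 + (x_j + x_k)²) + (y_j − y_k)²/(1 + (x_j − x_k)²)) > 0. -/

import Mathlib

/-- `g_a(θ) = (1/2)(arctan((θ+Im a)/Re a) + arctan((θ−Im a)/Re a))`. -/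
noncomputable def gfun (a : ℂ) (θ : ℝ) : ℝ :=
  (Real.arctan ((θ + a.im) / a.re) + Real.arctan ((θ - a.im) / a.re)) / 2

/-- `G_a(s) = ∫₀ˢ g_a(θ) dθ`. -/
noncomputable def Gfun (a : ℂ) (s : ℝ) : ℝ := ∫ θ in (0:ℝ)..s, gfun a θ

/-- `F(s) = ∫₀ˢ arctan(θ) dθ`. -/
noncomputable def Ffun (s : ℝ) : ℝ := ∫ θ in (0:ℝ)..s, Real.arctan θ

/-- The Wilson Morse function
`W(x) = Σ_{j<k} (F(x_j + x_k) + F(x_j − x_k))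
        + Σ_j (G_a(x_j) + G_b(x_j) + G_c(x_j) + G_d(x_j) − π·j·x_j)`,
with `j, k` running through `1, …, n` (so a Lean index `j : Fin n` corresponds to `j+1`). -/
noncomputable def W (n : ℕ) (a b c d : ℂ) (x : Fin n → ℝ) : ℝ :=
  (∑ j : Fin n, ∑ k : Fin n, if j < k then Ffun (x j + x k) + Ffun (x j - x k) else 0)
  + ∑ j : Fin n, (Gfun a (x j) + Gfun b (x j) + Gfun c (x j) + Gfun d (x j)
      - Real.pi * (((j : ℕ) : ℝ) + 1) * x j)

/-- Non-real parameters among `{a,b,c,d}` occur in complex-conjugate pairs, i.e. the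
multiset `{a,b,c,d}` is invariant under complex conjugation. -/
def QuadCond (a b c d : ℂ) : Prop :=
  Multiset.map (starRingEnd ℂ) {a, b, c, d} = ({a, b, c, d} : Multiset ℂ)

/-- Second partial derivative `∂²f/∂x_j∂x_k` of `f : ℝⁿ → ℝ` at `x`. -/
noncomputable def Hess (n : ℕ) (f : (Fin n → ℝ) → ℝ) (x : Fin n → ℝ) (j k : Fin n) : ℝ :=
  fderiv ℝ (fun z => fderiv ℝ f z (Pi.single k 1)) x (Pi.single j 1)

/-- The `j`-th coordinate as a continuous linear functional. -/
abbrev coordCLM {n : ℕ} (j : Fin n) : (Fin n → ℝ) →L[ℝ] ℝ :=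
  ContinuousLinearMap.proj j

/-- The derivative at `z` of a sum of functions of the coordinates and of their pairwise sums and
differences. -/
theorem hasFDerivAt_pair_sum {n : ℕ} {p q : Fin n → Fin n → ℝ → ℝ} {h : Fin n → ℝ → ℝ}
    {p' q' : Fin n → Fin n → ℝ} {h' : Fin n → ℝ} {z : Fin n → ℝ}
    (hp : ∀ j k, HasDerivAt (p j k) (p' j k) (z j + z k))
    (hq : ∀ j k, HasDerivAt (q j k) (q' j k) (z j - z k))
    (hh : ∀ j, HasDerivAt (h j) (h' j) (z j)) :
    HasFDerivAt
      (fun z : Fin n → ℝ =>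
        (∑ j, ∑ k, if j < k then p j k (z j + z k) + q j k (z j - z k) else 0) + ∑ j, h j (z j))
      ((∑ j, ∑ k, if j < k then
          p' j k • (coordCLM j
            + coordCLM k)
          + q' j k • (coordCLM j - coordCLM k) else 0)
        + ∑ j, h' j • coordCLM j) z := by
  have hproj : ∀ j : Fin n, HasFDerivAt (fun z : Fin n → ℝ => z j)
      (coordCLM j) z :=
    fun j => hasFDerivAt_apply j z
  refine .add (.fun_sum fun j _ => .fun_sum fun k _ => ?_) (.fun_sum fun j _ => ?_)
  · split_ifs
    · exact ((hp j k).comp_hasFDerivAt z ((hproj j).add (hproj k))).add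
        ((hq j k).comp_hasFDerivAt z ((hproj j).sub (hproj k)))
    · exact hasFDerivAt_const 0 z
  · exact (hh j).comp_hasFDerivAt z (hproj j)

theorem hasDerivAt_Ffun (s : ℝ) : HasDerivAt Ffun (Real.arctan s) s :=
  Real.continuous_arctan.integral_hasStrictDerivAt 0 s |>.hasDerivAt

theorem continuous_gfun (a : ℂ) : Continuous (gfun a) := by
  unfold gfun
  fun_prop

theorem hasDerivAt_Gfun (a : ℂ) (s : ℝ) : HasDerivAt (Gfun a) (gfun a s) s :=
  (continuous_gfun a).integral_hasStrictDerivAt 0 s |>.hasDerivAt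

theorem re_div_sq_add_sq {a : ℂ} (ha : 0 < a.re) (s : ℝ) :
    (a / (a ^ 2 + (s : ℂ) ^ 2)).re =
      (a.re / (a.re ^ 2 + (s + a.im) ^ 2) + a.re / (a.re ^ 2 + (s - a.im) ^ 2)) / 2 := by
  have h₁ : a + s * Complex.I ≠ 0 := fun h => by
    have := congrArg Complex.re h
    simp at this
    exact ha.ne' this
  have h₂ : a - s * Complex.I ≠ 0 := fun h => by
    have := congrArg Complex.re h
    simp at this
    exact ha.ne' this
  have hfac : a ^ 2 + (s : ℂ) ^ 2 = (a + s * Complex.I) * (a - s * Complex.I) := by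
    ring_nf
    simp
  have hsplit : a / (a ^ 2 + (s : ℂ) ^ 2) =
      ((a + s * Complex.I)⁻¹ + (a - s * Complex.I)⁻¹) / (2 : ℝ) := by
    rw [hfac]
    push_cast
    field_simp
    ring
  rw [hsplit, Complex.div_ofReal_re, Complex.add_re, Complex.inv_re, Complex.inv_re,
    Complex.normSq_apply, Complex.normSq_apply]
  simp only [Complex.add_re, Complex.sub_re, Complex.add_im, Complex.sub_im, Complex.mul_re,
    Complex.mul_im, Complex.ofReal_re, Complex.ofReal_im, Complex.I_re, Complex.I_im]
  ring_nf

theorem re_div_sq_add_sq_pos {a : ℂ} (ha : 0 < a.re) (s : ℝ) :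
    0 < (a / (a ^ 2 + (s : ℂ) ^ 2)).re := by
  rw [re_div_sq_add_sq ha]
  positivity

theorem hasDerivAt_gfun {a : ℂ} (ha : 0 < a.re) (s : ℝ) :
    HasDerivAt (gfun a) (a / (a ^ 2 + (s : ℂ) ^ 2)).re s := by
  rw [re_div_sq_add_sq ha]
  refine ((((hasDerivAt_id' s).add_const a.im).div_const a.re).arctan.add
    (((hasDerivAt_id' s).sub_const a.im).div_const a.re).arctan).div_const 2 |>.congr_deriv ?_
  have := ha.ne'
  field_simp

/-- The differential of `W` at `z`, applied to `v`. -/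
theorem fderiv_W (n : ℕ) (a b c d : ℂ) (z v : Fin n → ℝ) :
    fderiv ℝ (W n a b c d) z v =
      (∑ j, ∑ k, if j < k then Real.arctan (z j + z k) * (v j + v k)
        + Real.arctan (z j - z k) * (v j - v k) else 0)
      + ∑ j : Fin n, (gfun a (z j) + gfun b (z j) + gfun c (z j) + gfun d (z j)
        - Real.pi * (((j : ℕ) : ℝ) + 1)) * v j := by
  have h := hasFDerivAt_pair_sum (z := z) (fun _ _ => hasDerivAt_Ffun _)
    (fun _ _ => hasDerivAt_Ffun _)
    (fun j => ((((hasDerivAt_Gfun a (z j)).add (hasDerivAt_Gfun b _)).add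
      (hasDerivAt_Gfun c _)).add (hasDerivAt_Gfun d _)).sub
      ((hasDerivAt_id (z j)).const_mul (Real.pi * (((j : ℕ) : ℝ) + 1))))
  have hW : HasFDerivAt (W n a b c d) _ z := h
  rw [hW.fderiv]
  simp only [add_apply, sum_apply, mul_one]
  congr 1
  refine Finset.sum_congr rfl fun j _ => Finset.sum_congr rfl fun k _ => ?_
  split_ifs <;> simp [mul_add]

/-- The differential of `z ↦ dW_z(v)` at `x`, whose value at `u` is the Hessian form `H(u, v)`. -/
theorem hasFDerivAt_fderiv_W (n : ℕ) {a b c d : ℂ}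
    (ha : 0 < a.re) (hb : 0 < b.re) (hc : 0 < c.re) (hd : 0 < d.re) (x v : Fin n → ℝ) :
    HasFDerivAt (fun z => fderiv ℝ (W n a b c d) z v)
      ((∑ j, ∑ k, if j < k then
          (1 / (1 + (x j + x k) ^ 2) * (v j + v k)) •
            (coordCLM j
              + coordCLM k)
          + (1 / (1 + (x j - x k) ^ 2) * (v j - v k)) •
            (coordCLM j - coordCLM k) else 0)
        + ∑ j, (((a / (a ^ 2 + (x j : ℂ) ^ 2)).re + (b / (b ^ 2 + (x j : ℂ) ^ 2)).re
            + (c / (c ^ 2 + (x j : ℂ) ^ 2)).re + (d / (d ^ 2 + (x j : ℂ) ^ 2)).re) * v j) •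
          coordCLM j) x := by
  simp only [fderiv_W]
  exact hasFDerivAt_pair_sum
    (p := fun j k s => Real.arctan s * (v j + v k))
    (q := fun j k s => Real.arctan s * (v j - v k))
    (h := fun j s => (gfun a s + gfun b s + gfun c s + gfun d s
      - Real.pi * (((j : ℕ) : ℝ) + 1)) * v j)
    (fun j k => (Real.hasDerivAt_arctan (x j + x k)).mul_const (v j + v k))
    (fun j k => (Real.hasDerivAt_arctan (x j - x k)).mul_const (v j - v k))
    (fun j => (((((hasDerivAt_gfun ha (x j)).add (hasDerivAt_gfun hb _)).add
      (hasDerivAt_gfun hc _)).add (hasDerivAt_gfun hd _)).sub_const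
      (Real.pi * (((j : ℕ) : ℝ) + 1))).mul_const (v j))

/-- The quadratic form of the matrix of second partial derivatives is the iterated directional
derivative. -/
theorem sum_mul_Hess {n : ℕ} {f : (Fin n → ℝ) → ℝ} {x : Fin n → ℝ}
    (hf : ∀ v, DifferentiableAt ℝ (fun z => fderiv ℝ f z v) x) (y : Fin n → ℝ) :
    ∑ j, ∑ k, y j * y k * Hess n f x j k = fderiv ℝ (fun z => fderiv ℝ f z y) x y := by
  have hexp : ∀ L : (Fin n → ℝ) →L[ℝ] ℝ, L y = ∑ j, y j * L (Pi.single j 1) := fun L => by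
    conv_lhs => rw [pi_eq_sum_univ' y]
    simp [map_sum]
  have houter : (fun z => fderiv ℝ f z y) =
      fun z => ∑ k, y k * fderiv ℝ f z (Pi.single k 1) := funext fun z => hexp _
  rw [houter, fderiv_fun_sum fun k _ => (hf _).const_mul _, hexp]
  refine Finset.sum_congr rfl fun j _ => ?_
  rw [sum_apply, Finset.mul_sum]
  refine Finset.sum_congr rfl fun k _ => ?_
  rw [fderiv_const_mul (hf _)]
  simp [Hess, mul_assoc]

/-- the Wilson Morse function `W` is strictly convex: for every `x` and
every `y ≠ 0`, the Hessian quadratic form equals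
`Σ_j (Σ_{ε∈{a,b,c,d}} Re(ε/(ε²+x_j²))) y_j²
  + Σ_{j<k} ((y_j+y_k)²/(1+(x_j+x_k)²) + (y_j−y_k)²/(1+(x_j−x_k)²))` and is positive. -/
theorem wilson_morse_strictly_convex
    (n : ℕ) (hn : 1 ≤ n) (a b c d : ℂ)
    (ha : 0 < a.re) (hb : 0 < b.re) (hc : 0 < c.re) (hd : 0 < d.re)
    (habcd : QuadCond a b c d)
    (x y : Fin n → ℝ) (hy : y ≠ 0) :
    (∑ j : Fin n, ∑ k : Fin n, y j * y k * Hess n (W n a b c d) x j k)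
      = (∑ j : Fin n, ((a / (a ^ 2 + (x j : ℂ) ^ 2)).re
            + (b / (b ^ 2 + (x j : ℂ) ^ 2)).re
            + (c / (c ^ 2 + (x j : ℂ) ^ 2)).re
            + (d / (d ^ 2 + (x j : ℂ) ^ 2)).re) * (y j) ^ 2)
        + (∑ j : Fin n, ∑ k : Fin n,
            if j < k then (y j + y k) ^ 2 / (1 + (x j + x k) ^ 2)
              + (y j - y k) ^ 2 / (1 + (x j - x k) ^ 2) else 0) ∧
    0 < ∑ j : Fin n, ∑ k : Fin n, y j * y k * Hess n (W n a b c d) x j k := by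
  have hform : (∑ j : Fin n, ∑ k : Fin n, y j * y k * Hess n (W n a b c d) x j k)
      = (∑ j : Fin n, ((a / (a ^ 2 + (x j : ℂ) ^ 2)).re
            + (b / (b ^ 2 + (x j : ℂ) ^ 2)).re
            + (c / (c ^ 2 + (x j : ℂ) ^ 2)).re
            + (d / (d ^ 2 + (x j : ℂ) ^ 2)).re) * (y j) ^ 2)
        + (∑ j : Fin n, ∑ k : Fin n,
            if j < k then (y j + y k) ^ 2 / (1 + (x j + x k) ^ 2)
              + (y j - y k) ^ 2 / (1 + (x j - x k) ^ 2) else 0) := by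
    have hD := hasFDerivAt_fderiv_W n ha hb hc hd x
    rw [sum_mul_Hess (fun v => (hD v).differentiableAt), (hD y).fderiv, add_comm]
    simp only [add_apply, sum_apply]
    congr 1
    · refine Finset.sum_congr rfl fun j _ => ?_
      simp only [smul_apply, ContinuousLinearMap.proj_apply, smul_eq_mul]
      ring
    · refine Finset.sum_congr rfl fun j _ => Finset.sum_congr rfl fun k _ => ?_
      split_ifs
      · simp only [add_apply, sub_apply,
          smul_apply, ContinuousLinearMap.proj_apply, smul_eq_mul]
        ring
      · rfl
  refine ⟨hform, ?_⟩
  rw [hform]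
  have hpos : ∀ j, 0 < (a / (a ^ 2 + (x j : ℂ) ^ 2)).re + (b / (b ^ 2 + (x j : ℂ) ^ 2)).re
      + (c / (c ^ 2 + (x j : ℂ) ^ 2)).re + (d / (d ^ 2 + (x j : ℂ) ^ 2)).re := fun j =>
    add_pos (add_pos (add_pos (re_div_sq_add_sq_pos ha _) (re_div_sq_add_sq_pos hb _))
      (re_div_sq_add_sq_pos hc _)) (re_div_sq_add_sq_pos hd _)
  obtain ⟨i, hi⟩ := Function.ne_iff.mp hy
  refine add_pos_of_pos_of_nonneg
    (Finset.sum_pos' (fun j _ => mul_nonneg (hpos j).le (sq_nonneg _))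
      ⟨i, Finset.mem_univ i, mul_pos (hpos i) (sq_pos_of_ne_zero hi)⟩)
    (Finset.sum_nonneg fun j _ => Finset.sum_nonneg fun k _ => ?_)
  split_ifs <;> positivity
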